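/- arXiv:2503.00328 — 2 statements merged into one kernel-verified Lean document; each statement's English description precedes it below -/
import Mathlib

section
/- Let P be a polynomial with complex coefficients of degree n having no zeros in the open unit disk {z : |z| < 1}, let a be a complex number with |a| ≤ 1, and let α be a complex number with |α| ≤ 1. Then for every real R ≥ 1 and every complex z with |z| ≥ 1, |S̃_a[P](Rz) − α·S̃_a[P](z)| ≤ (1/2)·( |R^n − α| · n|z|^(n−1) + n·|1 − α|·|a| ) · max_{|w|=1} |P(w)|. -/
open Polynomial

/-- The modified Smirnov operator: S̃ₐ[P](z) = (1+az)·P′(z) − n·a·P(z). -/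
noncomputable def smirnov (n : ℕ) (a : ℂ) (P : Polynomial ℂ) (z : ℂ) : ℂ :=
  (1 + a * z) * P.derivative.eval z - (n : ℂ) * a * P.eval z

/-- The maximum of ‖P‖ on the unit circle. -/
noncomputable def maxCircle (P : Polynomial ℂ) : ℝ :=
  sSup {y : ℝ | ∃ w : ℂ, ‖w‖ = 1 ∧ y = ‖P.eval w‖}

open ComplexConjugate in
/-- For `p` of degree `n` with all roots in the closed unit disk, the Smirnov operator with parameter
in the open disk does not vanish outside the closed disk. -/
theorem smirnov_ne_zero {n : ℕ} (hn : n ≠ 0) {p : ℂ[X]} (hp : p.natDegree = n)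
    (hroots : ∀ w : ℂ, 1 < ‖w‖ → p.eval w ≠ 0) {a : ℂ} (ha : ‖a‖ < 1) {w : ℂ} (hw : 1 < ‖w‖) :
    smirnov n a p w ≠ 0 := by
  have hs : p.Splits := IsAlgClosed.splits p
  have hpw := hroots w hw
  have hcard : p.roots.card = n := by rw [← hs.natDegree_eq_card_roots, hp]
  have key : ∀ ζ ∈ p.roots,
      0 < (((1 + a * w) * (1 / (w - ζ)) - a) * (w + conj a)).re := by
    intro ζ hζ
    have hζ1 : ‖ζ‖ ≤ 1 := by
      by_contra! h
      exact hroots ζ h (Polynomial.isRoot_of_mem_roots hζ)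
    have hd : w - ζ ≠ 0 := by
      intro h
      rw [sub_eq_zero] at h
      rw [h] at hw
      linarith
    have hN : 0 < Complex.normSq (w - ζ) := Complex.normSq_pos.2 hd
    have e : ((1 + a * w) * (1 / (w - ζ)) - a) * (w + conj a)
        = ((1 + a * ζ) * (w + conj a) * conj (w - ζ)) * ((Complex.normSq (w - ζ))⁻¹ : ℝ) := by
      rw [one_div, Complex.inv_def]
      have : (1 : ℂ) = (w - ζ) * (conj (w - ζ) * ((Complex.normSq (w - ζ))⁻¹ : ℝ)) := by
        rw [← Complex.inv_def, mul_inv_cancel₀ hd]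
      linear_combination (-a * (w + conj a)) * this
    rw [e, Complex.re_mul_ofReal]
    refine mul_pos ?_ (inv_pos.2 hN)
    have h1 : Complex.normSq ζ ≤ 1 := by
      rw [Complex.normSq_eq_norm_sq]; nlinarith [norm_nonneg ζ]
    have h2 : 1 < Complex.normSq w := by
      rw [Complex.normSq_eq_norm_sq]; nlinarith
    have h3 : Complex.normSq a < 1 := by
      rw [Complex.normSq_eq_norm_sq]; nlinarith [norm_nonneg a]
    have id : 2 * ((1 + a * ζ) * (w + conj a) * conj (w - ζ)).re
        = (Complex.normSq w - 1) * Complex.normSq (1 + a * ζ)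
          + (1 - Complex.normSq a) * Complex.normSq (w - ζ)
          + Complex.normSq (1 + a * w) * (1 - Complex.normSq ζ) := by
      simp only [Complex.normSq_apply, Complex.mul_re, Complex.mul_im, Complex.add_re,
        Complex.add_im, Complex.sub_re, Complex.sub_im, Complex.conj_re, Complex.conj_im,
        Complex.one_re, Complex.one_im]
      ring
    have := mul_pos (sub_pos.2 h3) hN
    have := mul_nonneg (sub_nonneg.2 h2.le) (Complex.normSq_nonneg (1 + a * ζ))
    have := mul_nonneg (Complex.normSq_nonneg (1 + a * w)) (sub_nonneg.2 h1)
    linarith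
  have hsum : smirnov n a p w * (w + conj a)
      = p.eval w * (p.roots.map fun ζ ↦
        ((1 + a * w) * (1 / (w - ζ)) - a) * (w + conj a)).sum := by
    rw [Multiset.sum_map_mul_right, Multiset.sum_map_sub, Multiset.sum_map_mul_left,
      Multiset.map_const', Multiset.sum_replicate, hcard,
      ← hs.eval_derivative_div_eval_of_ne_zero hpw, smirnov, nsmul_eq_mul]
    field_simp
  intro h0
  rw [h0, zero_mul, eq_comm, mul_eq_zero, or_iff_right hpw] at hsum
  have hre := congrArg Complex.reAddGroupHom hsum
  rw [map_multiset_sum, Multiset.map_map, map_zero] at hre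
  have hne : p.roots ≠ 0 := by
    rw [← Multiset.card_pos, hcard]
    omega
  have : (p.roots.map fun _ ↦ (0 : ℝ)).sum < (p.roots.map (Complex.reAddGroupHom ∘ fun ζ ↦
      ((1 + a * w) * (1 / (w - ζ)) - a) * (w + conj a))).sum :=
    Multiset.sum_lt_sum_of_nonempty hne fun ζ hζ ↦ key ζ hζ
  simp only [Multiset.map_const', Multiset.sum_replicate, smul_zero] at this
  exact this.ne' hre

theorem norm_eval_eq_prod_roots (p : ℂ[X]) (x : ℂ) :
    ‖p.eval x‖ = ‖p.leadingCoeff‖ * (p.roots.map fun ζ ↦ ‖x - ζ‖).prod := by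
  rw [(IsAlgClosed.splits p).eval_eq_prod_roots, norm_mul]
  congr 1
  rw [← coe_nnnorm, ← nnnormHom_apply, map_multiset_prod, Multiset.map_map]
  simp [NNReal.coe_multiset_prod, Multiset.map_map, Function.comp_def]

/-- A polynomial with all roots in the closed unit disk grows radially outside of it. -/
theorem norm_eval_le_norm_eval_mul {p : ℂ[X]} (hroots : ∀ w : ℂ, 1 < ‖w‖ → p.eval w ≠ 0)
    {R : ℝ} (hR : 1 ≤ R) {z : ℂ} (hz : 1 ≤ ‖z‖) : ‖p.eval z‖ ≤ ‖p.eval (R * z)‖ := by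
  rw [norm_eval_eq_prod_roots, norm_eval_eq_prod_roots p (R * z)]
  refine mul_le_mul_of_nonneg_left
    (Multiset.prod_map_le_prod_map₀ _ _ (fun _ _ ↦ norm_nonneg _) fun ζ hζ ↦ ?_) (norm_nonneg _)
  have hζ1 : ‖ζ‖ ≤ 1 := by
    by_contra! h
    exact hroots ζ h (Polynomial.isRoot_of_mem_roots hζ)
  have hζz : Complex.normSq ζ ≤ Complex.normSq z := by
    simp only [Complex.normSq_eq_norm_sq]
    gcongr
    linarith
  rw [← sq_le_sq₀ (norm_nonneg _) (norm_nonneg _), ← Complex.normSq_eq_norm_sq,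
    ← Complex.normSq_eq_norm_sq]
  simp only [Complex.normSq_apply, Complex.sub_re, Complex.sub_im, Complex.re_ofReal_mul,
    Complex.im_ofReal_mul] at hζz ⊢
  have h1 : 0 ≤ (R - 1) * ((z.re * z.re + z.im * z.im) - (ζ.re * ζ.re + ζ.im * ζ.im)) :=
    mul_nonneg (by linarith) (by linarith)
  have h2 : 0 ≤ (R - 1) * ((z.re - ζ.re) ^ 2 + (z.im - ζ.im) ^ 2) :=
    mul_nonneg (by linarith) (by positivity)
  have h3 : 0 ≤ (R - 1) ^ 2 * (z.re ^ 2 + z.im ^ 2) := by positivity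
  nlinarith

theorem eval_reflect {n : ℕ} {p : ℂ[X]} (hp : p.natDegree ≤ n) {u : ℂ} (hu : u ≠ 0) :
    (p.reflect n).eval u = u ^ n * p.eval u⁻¹ := by
  let _ : Invertible u⁻¹ := invertibleOfNonzero (inv_ne_zero hu)
  have h := eval₂_reflect_mul_pow (RingHom.id ℂ) u⁻¹ n p hp
  simp only [invOf_eq_inv, inv_inv] at h
  rw [eval, eval, ← h, inv_pow]
  field_simp

open ComplexConjugate in
theorem norm_eval_map_conj (p : ℂ[X]) (u : ℂ) :
    ‖(p.map (starRingEnd ℂ)).eval u‖ = ‖p.eval (conj u)‖ := by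
  have h := eval_map_apply (starRingEnd ℂ) (conj u) (p := p)
  rw [Complex.conj_conj] at h
  rw [h, Complex.norm_conj]

open ComplexConjugate Topology in
theorem norm_eval_reflect_le {n : ℕ} {p : ℂ[X]} (hp : p.natDegree ≤ n)
    (hroots : ∀ w : ℂ, ‖w‖ < 1 → p.eval w ≠ 0) {u : ℂ} (hu : ‖u‖ < 1) :
    ‖(p.reflect n).eval u‖ ≤ ‖(p.map (starRingEnd ℂ)).eval u‖ := by
  have main : ∀ u : ℂ, ‖u‖ < 1 → u ≠ 0 →
      ‖(p.reflect n).eval u‖ ≤ ‖(p.map (starRingEnd ℂ)).eval u‖ := by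
    intro u hu hu0
    rw [eval_reflect hp hu0, norm_eval_map_conj, norm_mul, norm_pow,
      norm_eval_eq_prod_roots, norm_eval_eq_prod_roots p (conj u)]
    have hcard : p.roots.card ≤ n := (card_roots' p).trans hp
    calc ‖u‖ ^ n * (‖p.leadingCoeff‖ * (p.roots.map fun ζ ↦ ‖u⁻¹ - ζ‖).prod)
        ≤ ‖u‖ ^ p.roots.card * (‖p.leadingCoeff‖ * (p.roots.map fun ζ ↦ ‖u⁻¹ - ζ‖).prod) := by
          refine mul_le_mul_of_nonneg_right (pow_le_pow_of_le_one (norm_nonneg _) hu.le hcard) ?_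
          rw [← norm_eval_eq_prod_roots]
          exact norm_nonneg _
      _ = ‖p.leadingCoeff‖ * (p.roots.map fun ζ ↦ ‖u‖ * ‖u⁻¹ - ζ‖).prod := by
          rw [Multiset.prod_map_mul, Multiset.map_const', Multiset.prod_replicate]
          ring
      _ ≤ _ := by
          refine mul_le_mul_of_nonneg_left (Multiset.prod_map_le_prod_map₀ _ _
            (fun _ _ ↦ by positivity) fun ζ hζ ↦ ?_) (norm_nonneg _)
          have hζ1 : 1 ≤ ‖ζ‖ := by
            by_contra! h
            exact hroots ζ h (Polynomial.isRoot_of_mem_roots hζ)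
          rw [← norm_mul, mul_sub, mul_inv_cancel₀ hu0,
            ← sq_le_sq₀ (norm_nonneg _) (norm_nonneg _), ← Complex.normSq_eq_norm_sq,
            ← Complex.normSq_eq_norm_sq]
          have h1 : Complex.normSq u ≤ 1 := by
            rw [Complex.normSq_eq_norm_sq]; nlinarith [norm_nonneg u]
          have h2 : 1 ≤ Complex.normSq ζ := by
            rw [Complex.normSq_eq_norm_sq]; nlinarith
          have h3 := mul_nonneg (sub_nonneg.2 h1) (sub_nonneg.2 h2)
          simp only [Complex.normSq_apply, Complex.sub_re, Complex.sub_im, Complex.mul_re,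
            Complex.mul_im, Complex.conj_re, Complex.conj_im, Complex.one_re,
            Complex.one_im] at h3 ⊢
          linarith
  rcases eq_or_ne u 0 with rfl | hu0
  · have hf : Filter.Tendsto (fun x ↦ ‖(p.reflect n).eval x‖) (𝓝[≠] (0 : ℂ))
        (𝓝 ‖(p.reflect n).eval 0‖) :=
      ((p.reflect n).continuous.norm.tendsto 0).mono_left nhdsWithin_le_nhds
    have hg : Filter.Tendsto (fun x ↦ ‖(p.map (starRingEnd ℂ)).eval x‖) (𝓝[≠] (0 : ℂ))
        (𝓝 ‖(p.map (starRingEnd ℂ)).eval 0‖) :=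
      ((p.map (starRingEnd ℂ)).continuous.norm.tendsto 0).mono_left nhdsWithin_le_nhds
    refine le_of_tendsto_of_tendsto hf hg ?_
    filter_upwards [self_mem_nhdsWithin,
      mem_nhdsWithin_of_mem_nhds (Metric.ball_mem_nhds (0 : ℂ) one_pos)] with x hx0 hx
    exact main x (by simpa using hx) hx0
  · exact main u hu hu0

/-- The difference `S̃ₐ[p](Rz) - α S̃ₐ[p](z)`. -/
noncomputable def smirnovDiff (n : ℕ) (a α : ℂ) (R : ℝ) (z : ℂ) (p : ℂ[X]) : ℂ :=
  smirnov n a p (R * z) - α * smirnov n a p z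

section SmirnovDiff

variable {n : ℕ} {a α z : ℂ} {R : ℝ}

theorem smirnovDiff_add (p q : ℂ[X]) :
    smirnovDiff n a α R z (p + q) = smirnovDiff n a α R z p + smirnovDiff n a α R z q := by
  simp only [smirnovDiff, smirnov, derivative_add, eval_add]
  ring

theorem smirnovDiff_C_mul (c : ℂ) (p : ℂ[X]) :
    smirnovDiff n a α R z (C c * p) = c * smirnovDiff n a α R z p := by
  simp only [smirnovDiff, smirnov, derivative_C_mul, eval_C_mul]
  ring

theorem smirnovDiff_C (c : ℂ) :
    smirnovDiff n a α R z (C c) = c * -(n * (1 - α) * a) := by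
  simp only [smirnovDiff, smirnov, derivative_C, eval_C, eval_zero]
  ring

theorem smirnovDiff_X_pow (hn : n ≠ 0) :
    smirnovDiff n a α R z (X ^ n) = ((R : ℂ) ^ (n - 1) - α) * (n * z ^ (n - 1)) := by
  obtain ⟨m, rfl⟩ := Nat.exists_eq_succ_of_ne_zero hn
  simp only [smirnovDiff, smirnov, derivative_X_pow, eval_mul, eval_pow, eval_X, eval_C,
    Nat.succ_eq_add_one, Nat.add_sub_cancel]
  ring

theorem smirnovDiff_reflect_ne_zero (hn : n ≠ 0) (ha : ‖a‖ < 1) (hα : ‖α‖ < 1) (hR : 1 ≤ R)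
    (hz : 1 < ‖z‖) {h : ℂ[X]} (hdeg : h.natDegree ≤ n)
    (hroots : ∀ u : ℂ, ‖u‖ < 1 → h.eval u ≠ 0) :
    smirnovDiff n a α R z (h.reflect n) ≠ 0 := by
  have hG : ∀ w : ℂ, 1 < ‖w‖ → (h.reflect n).eval w ≠ 0 := by
    intro w hw
    have hw0 : w ≠ 0 := norm_pos_iff.1 (one_pos.trans hw)
    rw [eval_reflect hdeg hw0]
    refine mul_ne_zero (pow_ne_zero _ hw0) (hroots _ ?_)
    rw [norm_inv]
    exact inv_lt_one_of_one_lt₀ hw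
  have hGdeg : (h.reflect n).natDegree = n := by
    refine le_antisymm (natDegree_reflect_le.trans (max_le le_rfl hdeg)) (le_natDegree_of_ne_zero ?_)
    rw [coeff_reflect, revAt_le le_rfl, Nat.sub_self, coeff_zero_eq_eval_zero]
    exact hroots 0 (by simp)
  set F : ℂ[X] := (1 + C a * X) * derivative (h.reflect n) - C ((n : ℂ) * a) * h.reflect n with hF
  have hFe : ∀ w, F.eval w = smirnov n a (h.reflect n) w := fun w ↦ by simp [hF, smirnov]
  have hF0 : ∀ w : ℂ, 1 < ‖w‖ → F.eval w ≠ 0 := fun w hw ↦ by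
    rw [hFe]
    exact smirnov_ne_zero hn hGdeg hG ha hw
  have hle := norm_eval_le_norm_eval_mul hF0 hR hz.le
  have hpos := norm_pos_iff.2 (hF0 z hz)
  rw [smirnovDiff, ← hFe, ← hFe, sub_ne_zero]
  intro heq
  rw [heq, norm_mul] at hle
  nlinarith

theorem norm_smirnovDiff_reflect_le (hn : n ≠ 0) (ha : ‖a‖ < 1) (hα : ‖α‖ < 1) (hR : 1 ≤ R)
    (hz : 1 < ‖z‖) {f g : ℂ[X]} (hf : f.natDegree ≤ n) (hg : g.natDegree ≤ n)
    (hroots : ∀ u : ℂ, ‖u‖ < 1 → g.eval u ≠ 0)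
    (hfg : ∀ u : ℂ, ‖u‖ < 1 → ‖f.eval u‖ ≤ ‖g.eval u‖) :
    ‖smirnovDiff n a α R z (f.reflect n)‖ ≤ ‖smirnovDiff n a α R z (g.reflect n)‖ := by
  by_contra! hlt
  have hg0 := smirnovDiff_reflect_ne_zero hn ha hα hR hz hg hroots
  set c := -(smirnovDiff n a α R z (f.reflect n) / smirnovDiff n a α R z (g.reflect n)) with hc
  have hc1 : 1 < ‖c‖ := by
    rw [hc, norm_neg, norm_div, one_lt_div (norm_pos_iff.2 hg0)]
    exact hlt
  refine smirnovDiff_reflect_ne_zero hn ha hα hR hz (h := f + C c * g)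
    (natDegree_add_le_of_degree_le hf ((natDegree_C_mul_le _ _).trans hg)) (fun u hu h0 ↦ ?_) ?_
  · rw [eval_add, eval_C_mul, add_eq_zero_iff_eq_neg] at h0
    have h1 := hfg u hu
    rw [h0, norm_neg, norm_mul] at h1
    have := norm_pos_iff.2 (hroots u hu)
    nlinarith
  · rw [reflect_add, reflect_C_mul, smirnovDiff_add, smirnovDiff_C_mul, hc]
    field_simp
    ring

theorem norm_smirnovDiff_le_reflect_conj (hn : n ≠ 0) (ha : ‖a‖ < 1) (hα : ‖α‖ < 1) (hR : 1 ≤ R)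
    (hz : 1 < ‖z‖) {p : ℂ[X]} (hp : p.natDegree ≤ n)
    (hroots : ∀ u : ℂ, ‖u‖ < 1 → p.eval u ≠ 0) :
    ‖smirnovDiff n a α R z p‖
      ≤ ‖smirnovDiff n a α R z ((p.map (starRingEnd ℂ)).reflect n)‖ := by
  have h := norm_smirnovDiff_reflect_le hn ha hα hR hz (f := p.reflect n)
    (g := p.map (starRingEnd ℂ)) (natDegree_reflect_le.trans (max_le le_rfl hp))
    (natDegree_map_le.trans hp) (fun u hu ↦ ?_) fun u hu ↦ norm_eval_reflect_le hp hroots hu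
  · rwa [reflect_reflect] at h
  · rw [← norm_ne_zero_iff, norm_eval_map_conj, norm_ne_zero_iff]
    exact hroots _ (by rwa [Complex.norm_conj])

end SmirnovDiff

theorem exists_norm_add_mul_le (x y : ℂ) (h : ‖x‖ ≤ ‖y‖) :
    ∃ μ : ℂ, ‖μ‖ = 1 ∧ ‖x + μ * y‖ ≤ ‖y‖ - ‖x‖ := by
  refine ⟨-Complex.exp ((x.arg - y.arg : ℝ) * Complex.I), ?_, ?_⟩
  · rw [norm_neg, Complex.norm_exp_ofReal_mul_I]
  · have e : x + -Complex.exp ((x.arg - y.arg : ℝ) * Complex.I) * y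
        = ((‖x‖ - ‖y‖ : ℝ) : ℂ) * Complex.exp (x.arg * Complex.I) := by
      have hexp : Complex.exp (x.arg * Complex.I)
          = Complex.exp ((x.arg - y.arg : ℝ) * Complex.I) * Complex.exp (y.arg * Complex.I) := by
        rw [← Complex.exp_add]
        push_cast
        ring_nf
      have hx := Complex.norm_mul_exp_arg_mul_I x
      have hy := Complex.norm_mul_exp_arg_mul_I y
      push_cast at hexp ⊢
      linear_combination -hx + Complex.exp ((x.arg - y.arg) * Complex.I) * hy + ‖y‖ * hexp
    rw [e, norm_mul, Complex.norm_exp_ofReal_mul_I, mul_one, Complex.norm_real, Real.norm_eq_abs,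
      abs_of_nonpos (by linarith)]
    linarith

theorem norm_eval_le_maxCircle (p : ℂ[X]) {w : ℂ} (hw : ‖w‖ ≤ 1) : ‖p.eval w‖ ≤ maxCircle p := by
  have hbdd : BddAbove {y : ℝ | ∃ w : ℂ, ‖w‖ = 1 ∧ y = ‖p.eval w‖} := by
    have h := ((isCompact_sphere (0 : ℂ) 1).image p.continuous.norm).bddAbove
    refine h.mono ?_
    rintro y ⟨w, hw, rfl⟩
    exact ⟨w, by simpa using hw, rfl⟩
  refine Complex.norm_le_of_forall_mem_frontier_norm_le (U := Metric.ball 0 1)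
    (f := fun x ↦ p.eval x) Metric.isBounded_ball p.differentiable.diffContOnCl (fun x hx ↦ ?_) ?_
  · rw [frontier_ball _ one_ne_zero] at hx
    exact le_csSup hbdd ⟨x, by simpa using hx, rfl⟩
  · rw [closure_ball _ one_ne_zero]
    simpa using hw

theorem norm_sub_le_norm_sub_of_le {α : ℂ} (hα : ‖α‖ ≤ 1) {s t : ℝ} (hs : 1 ≤ s) (hst : s ≤ t) :
    ‖(s : ℂ) - α‖ ≤ ‖(t : ℂ) - α‖ := by
  have hre : α.re ≤ 1 := (Complex.re_le_norm α).trans hα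
  rw [← sq_le_sq₀ (norm_nonneg _) (norm_nonneg _), ← Complex.normSq_eq_norm_sq,
    ← Complex.normSq_eq_norm_sq]
  simp only [Complex.normSq_apply, Complex.sub_re, Complex.sub_im, Complex.ofReal_re,
    Complex.ofReal_im]
  nlinarith

open ComplexConjugate in
theorem norm_smirnovDiff_le {n : ℕ} (hn : n ≠ 0) {a α z : ℂ} {R : ℝ} (ha : ‖a‖ < 1)
    (hα : ‖α‖ < 1) (hR : 1 ≤ R) (hz : 1 < ‖z‖) {p : ℂ[X]} (hp : p.natDegree ≤ n)
    (hroots : ∀ u : ℂ, ‖u‖ < 1 → p.eval u ≠ 0) :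
    ‖smirnovDiff n a α R z p‖ ≤ (1 / 2) * (‖(R : ℂ) ^ n - α‖ * ((n : ℝ) * ‖z‖ ^ (n - 1))
      + (n : ℝ) * ‖1 - α‖ * ‖a‖) * maxCircle p := by
  set T := smirnovDiff n a α R z with hT
  set q := p.map (starRingEnd ℂ) with hq
  have hqdeg : q.natDegree ≤ n := natDegree_map_le.trans hp
  have hbound : ∀ M, maxCircle p < M →
      2 * ‖T p‖ ≤ M * (‖T (X ^ n)‖ + n * ‖1 - α‖ * ‖a‖) := by
    intro M hM
    have hM0 : 0 < M :=
      ((norm_nonneg _).trans (norm_eval_le_maxCircle p (w := 0) (by simp))).trans_lt hM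
    have hTC : T (C (M : ℂ) * X ^ n) = M * T (X ^ n) := smirnovDiff_C_mul _ _
    have h1 : ‖T (q.reflect n)‖ ≤ ‖(M : ℂ) * T (X ^ n)‖ := by
      rw [← hTC, ← reflect_C]
      refine norm_smirnovDiff_reflect_le hn ha hα hR hz hqdeg (by simp) (fun u _ ↦ ?_) fun u hu ↦ ?_
      · simpa using hM0.ne'
      · rw [hq, norm_eval_map_conj, eval_C, Complex.norm_real, Real.norm_eq_abs, abs_of_pos hM0]
        exact (norm_eval_le_maxCircle p (by rw [Complex.norm_conj]; exact hu.le)).trans hM.le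
    obtain ⟨μ, hμ, hle⟩ := exists_norm_add_mul_le _ _ h1
    have h2 := norm_smirnovDiff_le_reflect_conj hn ha hα hR hz hp hroots
    have h3 := norm_smirnovDiff_le_reflect_conj hn ha hα hR hz (p := p + C (conj μ * M))
      (natDegree_add_le_of_degree_le hp ((natDegree_C _).trans_le n.zero_le)) fun u hu h0 ↦ by
        rw [eval_add, eval_C, add_eq_zero_iff_eq_neg] at h0
        have := norm_eval_le_maxCircle p hu.le
        rw [h0, norm_neg, norm_mul, Complex.norm_conj, hμ, one_mul, Complex.norm_real,
          Real.norm_eq_abs, abs_of_pos hM0] at this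
        linarith
    rw [Polynomial.map_add, map_C, reflect_add, reflect_C, smirnovDiff_add, smirnovDiff_add,
      smirnovDiff_C_mul, smirnovDiff_C, map_mul, Complex.conj_conj, Complex.conj_ofReal,
      mul_assoc μ] at h3
    have h4 := norm_sub_le_norm_add (T p) (conj μ * M * -(n * (1 - α) * a))
    rw [norm_mul, norm_neg, norm_mul, norm_mul, norm_mul, Complex.norm_conj, hμ, Complex.norm_real,
      Real.norm_eq_abs, abs_of_pos hM0, Complex.norm_natCast, one_mul] at h4
    have h5 := h3.trans hle
    rw [norm_mul, Complex.norm_real, Real.norm_eq_abs, abs_of_pos hM0] at h5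
    linarith
  have hlim : 2 * ‖T p‖ ≤ maxCircle p * (‖T (X ^ n)‖ + n * ‖1 - α‖ * ‖a‖) := by
    refine ge_of_tendsto (x := nhdsWithin (maxCircle p) (Set.Ioi (maxCircle p)))
      (f := fun M : ℝ ↦ M * (‖T (X ^ n)‖ + n * ‖1 - α‖ * ‖a‖)) ?_ ?_
    · exact (Continuous.tendsto (by fun_prop) _).mono_left nhdsWithin_le_nhds
    · filter_upwards [self_mem_nhdsWithin] with M hM using hbound M hM
  have hX : ‖T (X ^ n)‖ ≤ ‖(R : ℂ) ^ n - α‖ * ((n : ℝ) * ‖z‖ ^ (n - 1)) := by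
    rw [hT, smirnovDiff_X_pow hn, norm_mul, norm_mul, norm_pow, Complex.norm_natCast]
    refine mul_le_mul_of_nonneg_right ?_ (by positivity)
    have := norm_sub_le_norm_sub_of_le hα.le (one_le_pow₀ hR (n := n - 1))
      (pow_le_pow_right₀ hR (Nat.sub_le n 1))
    push_cast at this
    exact this
  have hM0 : 0 ≤ maxCircle p :=
    (norm_nonneg _).trans (norm_eval_le_maxCircle p (w := 0) (by simp))
  have := mul_le_mul_of_nonneg_left hX hM0
  linarith

theorem statement17 (n : ℕ) (P : Polynomial ℂ) (hP : P.natDegree = n)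
    (hP0 : ∀ w : ℂ, ‖w‖ < 1 → P.eval w ≠ 0)
    (a α : ℂ) (ha : ‖a‖ ≤ 1) (hα : ‖α‖ ≤ 1)
    (R : ℝ) (hR : 1 ≤ R) (z : ℂ) (hz : 1 ≤ ‖z‖) :
    ‖smirnov n a P ((R : ℂ) * z) - α * smirnov n a P z‖
      ≤ (1 / 2) * (‖(R : ℂ) ^ n - α‖ * ((n : ℝ) * ‖z‖ ^ (n - 1))
          + (n : ℝ) * ‖1 - α‖ * ‖a‖) * maxCircle P := by
  rcases eq_or_ne n 0 with rfl | hn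
  · simp [smirnov, derivative_of_natDegree_zero hP]
  have key : ∀ t : ℝ, t ∈ Set.Ioo (0 : ℝ) 1 →
      ‖smirnovDiff n (t * a) (t * α) R ((2 - t : ℝ) * z) P‖
        ≤ (1 / 2) * (‖(R : ℂ) ^ n - t * α‖ * ((n : ℝ) * ‖((2 - t : ℝ) : ℂ) * z‖ ^ (n - 1))
          + (n : ℝ) * ‖1 - t * α‖ * ‖t * a‖) * maxCircle P := by
    rintro t ⟨ht0, ht1⟩
    have hscale : ∀ b : ℂ, ‖b‖ ≤ 1 → ‖(t : ℂ) * b‖ < 1 := fun b hb ↦ by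
      rw [norm_mul, Complex.norm_real, Real.norm_eq_abs, abs_of_pos ht0]
      nlinarith [norm_nonneg b]
    refine norm_smirnovDiff_le hn (hscale a ha) (hscale α hα) hR ?_ hP.le hP0
    rw [norm_mul, Complex.norm_real, Real.norm_eq_abs, abs_of_pos (by linarith)]
    nlinarith
  have hcont : ∀ {f : ℝ → ℝ}, Continuous f →
      Filter.Tendsto f (nhdsWithin 1 (Set.Iio 1)) (nhds (f 1)) :=
    fun hf ↦ (hf.tendsto 1).mono_left nhdsWithin_le_nhds
  have hl := hcont (f := fun t ↦ ‖smirnovDiff n (t * a) (t * α) R ((2 - t : ℝ) * z) P‖) <| by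
    have h1 := P.continuous
    have h2 := (derivative P).continuous
    unfold smirnovDiff smirnov
    fun_prop
  have hr := hcont (f := fun t ↦ (1 / 2) * (‖(R : ℂ) ^ n - t * α‖
      * ((n : ℝ) * ‖((2 - t : ℝ) : ℂ) * z‖ ^ (n - 1))
      + (n : ℝ) * ‖1 - t * α‖ * ‖t * a‖) * maxCircle P) <| by fun_prop
  have hle := le_of_tendsto_of_tendsto hl hr <| by
    filter_upwards [Ioo_mem_nhdsLT (zero_lt_one' ℝ)] with t ht using key t ht
  norm_num at hle
  simpa [smirnovDiff] using hle
end

section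
/- Let P be a polynomial with complex coefficients of degree n such that |P(w)| ≤ M for all w with |w| = 1, and let a be a complex number with |a| ≤ 1. Then for every complex z with |z| ≥ 1, |(1+az)P′(z) − n·a·P(z)| ≤ M·n·|z|^(n−1). -/
open Polynomial

/-- The average of a nonempty multiset of points of a convex set belongs to the set. -/
theorem Convex.inv_card_smul_multiset_map_sum_mem {ι E : Type*} [AddCommGroup E] [Module ℝ E]
    {S : Set E} (hS : Convex ℝ S) (s : Multiset ι) (hs : s ≠ 0) (g : ι → E)
    (hg : ∀ i ∈ s, g i ∈ S) : (s.card : ℝ)⁻¹ • (s.map g).sum ∈ S := by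
  classical
  have hcard : (s.card : ℝ) ≠ 0 := by simpa using hs
  have key : (∑ i ∈ s.toFinset, ((s.card : ℝ)⁻¹ * s.count i) • g i) ∈ S := by
    refine hS.sum_mem (fun i _ ↦ by positivity) ?_ fun i hi ↦ hg i (by simpa using hi)
    rw [← Finset.mul_sum, ← Nat.cast_sum, Multiset.toFinset_sum_count_eq, inv_mul_cancel₀ hcard]
  simpa only [Finset.sum_multiset_map_count, Finset.smul_sum, mul_smul, Nat.cast_smul_eq_nsmul]
    using key

theorem norm_mul_sub_one_lt_norm_iff (z v : ℂ) :
    ‖z * v - 1‖ < ‖v‖ ↔ (‖z‖ ^ 2 - 1) * ‖v‖ ^ 2 + (-2 * (z * v).re) < -1 := by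
  rw [← sq_lt_sq₀ (norm_nonneg _) (norm_nonneg _)]
  simp only [← Complex.normSq_eq_norm_sq, Complex.normSq_apply, Complex.sub_re, Complex.sub_im,
    Complex.mul_re, Complex.mul_im, Complex.one_re, Complex.one_im]
  constructor <;> intro h <;> linarith

/-- For `1 ≤ ‖z‖`, the image of the open unit disc under
`w ↦ (z - w)⁻¹`, described by an inequality, is convex. -/
theorem convex_setOf_norm_mul_sub_one_lt_norm {z : ℂ} (hz : 1 ≤ ‖z‖) :
    Convex ℝ {v : ℂ | ‖z * v - 1‖ < ‖v‖} := by
  have hc : 0 ≤ ‖z‖ ^ 2 - 1 := by nlinarith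
  have h₁ : ConvexOn ℝ Set.univ fun v : ℂ ↦ (‖z‖ ^ 2 - 1) * ‖v‖ ^ 2 :=
    ((convexOn_univ_norm (E := ℂ)).pow (fun _ _ ↦ norm_nonneg _) 2).smul hc
  have h₂ : ConvexOn ℝ Set.univ fun v : ℂ ↦ -2 * (z * v).re :=
    ((-2 : ℝ) • (Complex.reLm ∘ₗ LinearMap.mulLeft ℝ z)).convexOn convex_univ
  simpa [norm_mul_sub_one_lt_norm_iff] using (h₁.add h₂).convex_lt (-1)

/-- A form of Laguerre's theorem: if all zeros of `f` lie in the open unit disc, then its modified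
Smirnov transform has no zeros outside the open unit disc. -/
theorem Polynomial.smirnov_ne_zero {f : ℂ[X]} (hdeg : f.natDegree ≠ 0)
    (hf : ∀ w : ℂ, 1 ≤ ‖w‖ → f.eval w ≠ 0) {a z : ℂ} (ha : ‖a‖ ≤ 1) (hz : 1 ≤ ‖z‖) :
    smirnov f.natDegree a f z ≠ 0 := by
  intro h
  have hsplit := IsAlgClosed.splits f
  have hfz := hf z hz
  have hcard : f.roots.card = f.natDegree := hsplit.natDegree_eq_card_roots.symm
  have hroots : f.roots ≠ 0 := by
    intro h0
    simp [h0, hdeg.symm] at hcard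
  have hn : (f.natDegree : ℂ) ≠ 0 := by exact_mod_cast hdeg
  have hmem := (convex_setOf_norm_mul_sub_one_lt_norm hz).inv_card_smul_multiset_map_sum_mem
    f.roots hroots (fun w ↦ 1 / (z - w)) fun w hw ↦ by
      have hw1 : ‖w‖ < 1 := by
        by_contra! hw1
        exact hf w hw1 (isRoot_of_mem_roots hw)
      have hzw : z - w ≠ 0 := fun h0 ↦ by
        rw [sub_eq_zero.mp h0] at hz
        linarith
      have hdiff : z * (1 / (z - w)) - 1 = w * (1 / (z - w)) := by
        field_simp
        ring
      have hpos : 0 < ‖1 / (z - w)‖ := norm_pos_iff.mpr (one_div_ne_zero hzw)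
      rw [Set.mem_ofPred_eq, hdiff, norm_mul]
      exact mul_lt_of_lt_one_left hpos hw1
  rw [← hsplit.eval_derivative_div_eval_of_ne_zero hfz, hcard, Set.mem_ofPred_eq,
    Complex.real_smul, Complex.ofReal_inv, Complex.ofReal_natCast] at hmem
  set v : ℂ := (f.natDegree : ℂ)⁻¹ * (f.derivative.eval z / f.eval z) with hv
  have hder : f.derivative.eval z = f.natDegree * v * f.eval z := by
    rw [hv]
    field_simp
  have hva : v = -(a * (z * v - 1)) := by
    have h0 : (f.natDegree * f.eval z) * (v + a * (z * v - 1)) = 0 := by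
      rw [← h, smirnov, hder]
      ring
    exact eq_neg_of_add_eq_zero_left ((mul_eq_zero.mp h0).resolve_left (mul_ne_zero hn hfz))
  have hle : ‖v‖ ≤ ‖z * v - 1‖ := by
    conv_lhs => rw [hva]
    rw [norm_neg, norm_mul]
    exact mul_le_of_le_one_left (norm_nonneg _) ha
  exact absurd hmem hle.not_gt

section CircleBound

variable {P : ℂ[X]} {M : ℝ}

theorem Polynomial.norm_eval_reverse_le (hM : ∀ w : ℂ, ‖w‖ = 1 → ‖P.eval w‖ ≤ M) {w : ℂ}
    (hw : ‖w‖ ≤ 1) : ‖P.reverse.eval w‖ ≤ M := by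
  refine Complex.norm_le_of_forall_mem_frontier_norm_le (U := Metric.ball 0 1)
    Metric.isBounded_ball P.reverse.differentiable.diffContOnCl (fun x hx ↦ ?_) ?_
  · rw [frontier_ball _ one_ne_zero, mem_sphere_zero_iff_norm] at hx
    have hx0 : x⁻¹ ≠ 0 := inv_ne_zero (norm_ne_zero_iff.mp (by simp [hx]))
    let _ := invertibleOfNonzero hx0
    have h := eval₂_reverse_mul_pow (RingHom.id ℂ) x⁻¹ P
    rw [invOf_eq_inv, inv_inv] at h
    have hn := congrArg norm h
    rw [norm_mul, norm_pow, norm_inv, hx, inv_one, one_pow, mul_one] at hn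
    exact hn.le.trans (hM _ (by simp [hx]))
  · rw [closure_ball _ one_ne_zero]
    simpa using hw

theorem Polynomial.norm_leadingCoeff_le (hM : ∀ w : ℂ, ‖w‖ = 1 → ‖P.eval w‖ ≤ M) :
    ‖P.leadingCoeff‖ ≤ M := by
  have h := norm_eval_reverse_le hM (w := 0) (by simp)
  rwa [← coeff_zero_eq_eval_zero, coeff_zero_reverse] at h

theorem Polynomial.norm_eval_le_mul_pow (hM : ∀ w : ℂ, ‖w‖ = 1 → ‖P.eval w‖ ≤ M) {z : ℂ}
    (hz : 1 ≤ ‖z‖) : ‖P.eval z‖ ≤ M * ‖z‖ ^ P.natDegree := by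
  have hz0 : z ≠ 0 := norm_pos_iff.mp (by linarith)
  let _ := invertibleOfNonzero hz0
  have h := eval₂_reverse_mul_pow (RingHom.id ℂ) z P
  rw [invOf_eq_inv] at h
  have hn := congrArg norm h
  rw [norm_mul, norm_pow] at hn
  refine hn.symm.le.trans ?_
  gcongr
  exact norm_eval_reverse_le hM (by simpa using inv_le_one_of_one_le₀ hz)

end CircleBound

theorem smirnov_sub_C_mul_X_pow (n : ℕ) (a μ : ℂ) (P : ℂ[X]) (z : ℂ) :
    smirnov n a (P - C μ * X ^ n) z = smirnov n a P z - μ * (n * z ^ (n - 1)) := by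
  rcases n with _ | n
  · simp [smirnov]
  · simp [smirnov]
    ring

theorem statement18 (n : ℕ) (P : Polynomial ℂ) (hP : P.natDegree = n)
    (M : ℝ) (hM : ∀ w : ℂ, ‖w‖ = 1 → ‖P.eval w‖ ≤ M)
    (a : ℂ) (ha : ‖a‖ ≤ 1) (z : ℂ) (hz : 1 ≤ ‖z‖) :
    ‖(1 + a * z) * P.derivative.eval z - (n : ℂ) * a * P.eval z‖
      ≤ M * (n : ℝ) * ‖z‖ ^ (n - 1) := by
  change ‖smirnov n a P z‖ ≤ _
  rcases eq_or_ne n 0 with rfl | hn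
  · rw [natDegree_eq_zero] at hP
    obtain ⟨c, rfl⟩ := hP
    simp [smirnov]
  have hz0 : z ≠ 0 := norm_pos_iff.mp (by linarith)
  have hd : (n : ℂ) * z ^ (n - 1) ≠ 0 := mul_ne_zero (by exact_mod_cast hn) (pow_ne_zero _ hz0)
  by_contra! hlt
  obtain ⟨μ, hμ⟩ : ∃ μ : ℂ, μ * (n * z ^ (n - 1)) = smirnov n a P z :=
    ⟨_, div_mul_cancel₀ _ hd⟩
  have hMμ : M < ‖μ‖ := by
    rw [← hμ, norm_mul, norm_mul, norm_pow, Complex.norm_natCast, mul_assoc] at hlt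
    exact lt_of_mul_lt_mul_right hlt (by positivity)
  have hdeg : (P - C μ * X ^ n).natDegree = n := by
    apply natDegree_eq_of_le_of_coeff_ne_zero
    · simpa using natDegree_sub_le_of_le hP.le (natDegree_C_mul_X_pow_le μ n)
    · rw [coeff_sub, coeff_C_mul_X_pow, if_pos rfl, sub_ne_zero]
      intro h
      have hl := norm_leadingCoeff_le hM
      rw [leadingCoeff, hP, h] at hl
      linarith
  have hroots : ∀ w : ℂ, 1 ≤ ‖w‖ → (P - C μ * X ^ n).eval w ≠ 0 := by
    intro w hw h
    have hle := norm_eval_le_mul_pow hM hw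
    rw [eval_sub, eval_mul, eval_C, eval_pow, eval_X, sub_eq_zero] at h
    rw [h, norm_mul, norm_pow, hP] at hle
    exact hMμ.not_ge (le_of_mul_le_mul_right hle (by positivity))
  have hne := smirnov_ne_zero (by rwa [hdeg]) hroots ha hz
  rw [hdeg, smirnov_sub_C_mul_X_pow, hμ, sub_self] at hne
  exact hne rfl
end
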